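/- arXiv:2211.12917 — 7 statements merged into one kernel-verified Lean document; each statement's English description precedes it below -/
import Mathlib

section
/- Let I and J be sets, let 𝔽 be a field, and let A : I × J → 𝔽 be a row-thin matrix. If the homogeneous thin linear equation system Ax = 0 (i.e. ∑_{j ∈ J} A(i,j)·x_j = 0 for every i ∈ I) has only the trivial solution λ = 0 in 𝔽^J, then there is an injection φ : J → I such that A(φ(j), j) ≠ 0 for every j ∈ J. -/
open Finsupp Submodule in
/-- If `single j 1` lies in the span of vectors `v i` (`i ∈ U`) and unit vectors `single s 1`
(`s ∈ S`) with `j ∉ S`, then some `v i` with `v i j ≠ 0` can be exchanged for `single j 1`. -/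
lemma exists_exchange_single {I J F : Type*} [Field F] (v : I → J →₀ F) {U : Set I} {S : Set J}
    {j : J} (hjS : j ∉ S)
    (hj : single j (1 : F) ∈ span F (v '' U ∪ (fun s ↦ single s (1 : F)) '' S)) :
    ∃ i ∈ U, v i j ≠ 0 ∧
      span F (v '' U ∪ (fun s ↦ single s (1 : F)) '' S) ≤
        span F (v '' (U \ {i}) ∪ (fun s ↦ single s (1 : F)) '' insert j S) := by
  classical
  rw [span_union, mem_sup] at hj
  obtain ⟨a, ha, b, hb, hab⟩ := hj
  rw [mem_span_image_iff_linearCombination] at ha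
  obtain ⟨l, hl, rfl⟩ := ha
  have hbj : b j = 0 := by
    rw [← supported_eq_span_single, mem_supported] at hb
    exact notMem_support_iff.mp fun h ↦ hjS (hb h)
  have hsum : ∑ i ∈ l.support, l i * v i j ≠ 0 := by
    have h := DFunLike.congr_fun hab j
    simp only [Finsupp.add_apply, hbj, add_zero, single_eq_same, linearCombination_apply, Finsupp.sum,
      finsetSum_apply, Finsupp.smul_apply, smul_eq_mul] at h
    simp [h]
  obtain ⟨i, hil, hi⟩ := Finset.exists_ne_zero_of_sum_ne_zero hsum
  have hlU : ∀ k ∈ l.support, k ∈ U := fun k hk ↦ (mem_supported F l).mp hl hk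
  refine ⟨i, hlU i hil, right_ne_zero_of_mul hi, ?_⟩
  set W := span F (v '' (U \ {i}) ∪ (fun s ↦ single s (1 : F)) '' insert j S)
  have hvW : ∀ k ∈ U, k ≠ i → v k ∈ W := fun k hk hki ↦
    subset_span (Or.inl ⟨k, ⟨hk, hki⟩, rfl⟩)
  have heW : ∀ s ∈ insert j S, single s (1 : F) ∈ W := fun s hs ↦
    subset_span (Or.inr ⟨s, hs, rfl⟩)
  have hbW : b ∈ W :=
    span_mono ((Set.image_mono (Set.subset_insert j S)).trans Set.subset_union_right) hb
  have hiW : v i ∈ W := by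
    rw [← W.smul_mem_iff (left_ne_zero_of_mul hi)]
    have h : l i • v i = single j 1 - b - ∑ k ∈ l.support.erase i, l k • v k := by
      rw [← hab, linearCombination_apply, Finsupp.sum, ← Finset.add_sum_erase _ _ hil]
      abel
    rw [h]
    refine W.sub_mem (W.sub_mem (heW j (Set.mem_insert j S)) hbW) (W.sum_mem fun k hk ↦ ?_)
    rw [Finset.mem_erase] at hk
    exact W.smul_mem _ (hvW k (hlU k hk.2) hk.1)
  rw [span_le]
  rintro _ (⟨k, hk, rfl⟩ | ⟨s, hs, rfl⟩)
  · by_cases hki : k = i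
    · exact hki ▸ hiW
    · exact hvW k hk hki
  · exact heW s (Set.mem_insert_of_mem j hs)

open Finsupp Submodule in
/-- A countable set `C` of coordinates whose unit vectors are spanned, modulo coordinates in a
disjoint set `S`, by the vectors `v i` with `i ∈ U` can be matched into `U` along nonzero
entries. -/
lemma exists_injOn_apply_ne_zero_of_countable {I J F : Type*} [Field F] (v : I → J →₀ F)
    {U : Set I} {S C : Set J} (hC : C.Countable) (hCS : Disjoint C S)
    (hspan : ∀ j ∈ C, single j (1 : F) ∈ span F (v '' U ∪ (fun s ↦ single s (1 : F)) '' S)) :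
    ∃ φ : C → I, Function.Injective φ ∧ ∀ j : C, φ j ∈ U ∧ v (φ j) j ≠ 0 := by
  let P := {G : Set (J × I) // (∀ p ∈ G, p.2 ∈ U ∧ v p.2 p.1 ≠ 0) ∧ Set.InjOn Prod.snd G ∧
    ∀ j ∈ C, single j (1 : F) ∈
      span F (v '' (U \ Prod.snd '' G) ∪ (fun s ↦ single s (1 : F)) '' (S ∪ Prod.fst '' G))}
  have hcofinal (j : C) : IsCofinal {G : P | ∃ i, ((j : J), i) ∈ G.1} := by
    rintro ⟨G, hG, hinj, hGspan⟩
    by_cases hjG : (j : J) ∈ Prod.fst '' G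
    · obtain ⟨⟨_, i⟩, hi, rfl⟩ := hjG
      exact ⟨⟨G, hG, hinj, hGspan⟩, ⟨i, hi⟩, le_rfl⟩
    have hjS : (j : J) ∉ S ∪ Prod.fst '' G := by
      rintro (h | h)
      exacts [Set.disjoint_left.mp hCS j.2 h, hjG h]
    obtain ⟨i, ⟨hiU, hiG⟩, hij, hle⟩ := exists_exchange_single v hjS (hGspan j j.2)
    refine ⟨⟨insert ((j : J), i) G, ?_, ?_, fun k hk ↦ ?_⟩, ⟨i, Set.mem_insert _ _⟩,
      Set.subset_insert _ _⟩
    · rintro p (rfl | hp)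
      exacts [⟨hiU, hij⟩, hG p hp]
    · rw [Set.injOn_insert fun h ↦ hiG ⟨_, h, rfl⟩]
      exact ⟨hinj, hiG⟩
    · have h := hle (hGspan k hk)
      rw [Set.sdiff_sdiff, Set.union_singleton, ← Set.union_insert] at h
      rwa [Set.image_insert_eq, Set.image_insert_eq]
  have := hC.to_subtype
  let _ := Encodable.ofCountable C
  let bot : P := ⟨∅, by simp, by simp, by simpa using hspan⟩
  let 𝒟 (j : C) : Order.Cofinal P := ⟨_, hcofinal j⟩
  have hmeet (j : C) : ∃ i, ∃ G ∈ Order.idealOfCofinals bot 𝒟, ((j : J), i) ∈ G.1 := by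
    obtain ⟨G, ⟨i, hi⟩, hG⟩ := Order.cofinal_meets_idealOfCofinals bot 𝒟 j
    exact ⟨i, G, hG, hi⟩
  choose φ G hG hφ using hmeet
  refine ⟨φ, fun j k hjk ↦ ?_, fun j ↦ (G j).2.1 _ (hφ j)⟩
  obtain ⟨H, -, hjH, hkH⟩ := (Order.idealOfCofinals bot 𝒟).directed _ (hG j) _ (hG k)
  exact Subtype.ext (congrArg Prod.fst (H.2.2.1 (hjH (hφ j)) (hkH (hφ k)) hjk))

lemma countable_setOf_reflTransGen {α : Type*} {r : α → α → Prop}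
    (hr : ∀ a, {b | r a b}.Countable) (a : α) : {b | Relation.ReflTransGen r a b}.Countable := by
  let T : ℕ → Set α := Nat.rec {a} fun _ s ↦ ⋃ x ∈ s, {b | r x b}
  have hT (n : ℕ) : (T n).Countable := by
    induction n with
    | zero => exact Set.countable_singleton a
    | succ n ih => exact ih.biUnion fun x _ ↦ hr x
  refine (Set.countable_iUnion hT).mono fun b (hb : Relation.ReflTransGen r a b) ↦ ?_
  induction hb with
  | refl => exact Set.mem_iUnion.mpr ⟨0, rfl⟩
  | tail _ hbc ih =>
    obtain ⟨n, hn⟩ := Set.mem_iUnion.mp ih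
    exact Set.mem_iUnion.mpr ⟨n + 1, Set.mem_biUnion hn hbc⟩

open Finsupp Submodule in
/-- A family spanning `J →₀ F` admits a matching of the coordinates into the family along nonzero
entries. -/
lemma exists_injective_apply_ne_zero_of_span_eq_top {I J F : Type*} [Field F] (v : I → J →₀ F)
    (hv : span F (Set.range v) = ⊤) :
    ∃ φ : J → I, Function.Injective φ ∧ ∀ j, v (φ j) j ≠ 0 := by
  have hfin (j : J) : ∃ t : Finset I, single j (1 : F) ∈ span F (v '' t) := by
    have hj : single j (1 : F) ∈ span F (v '' Set.univ) := by simp [hv]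
    obtain ⟨l, -, hl⟩ := mem_span_image_iff_linearCombination F |>.mp hj
    exact ⟨l.support, mem_span_image_iff_linearCombination F |>.mpr
      ⟨l, (mem_supported F l).mpr subset_rfl, hl⟩⟩
  choose t ht using hfin
  let r (j k : J) : Prop := ∃ i ∈ t j, v i k ≠ 0
  have hr (j : J) : {k | r j k}.Countable := by
    have h : {k | r j k} = ⋃ i ∈ t j, ((v i).support : Set J) := by
      ext k
      simp [r]
    rw [h]
    exact (t j).countable_toSet.biUnion fun i _ ↦ (v i).support.countable_toSet
  let C (k : J) : Set J := {j | Relation.ReflTransGen r k j}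
  let U (k : J) : Set I := ⋃ j ∈ C k, (t j : Set I)
  have hsupp {k : J} {i : I} (hi : i ∈ U k) : ((v i).support : Set J) ⊆ C k := by
    obtain ⟨j, hj, hij⟩ := Set.mem_iUnion₂.mp hi
    exact fun m hm ↦ Relation.ReflTransGen.tail hj ⟨i, hij, mem_support_iff.mp hm⟩
  obtain ⟨_, _⟩ := exists_wellFoundedLT J
  have hblock (k : J) := by
    refine exists_injOn_apply_ne_zero_of_countable v (U := U k \ ⋃ m < k, U m)
      (S := ⋃ m < k, C m) (C := C k \ ⋃ m < k, C m)
      ((countable_setOf_reflTransGen hr k).mono Set.sdiff_subset) Set.disjoint_sdiff_left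
      fun j hj ↦ span_le.mpr ?_ (ht j)
    rintro _ ⟨i, hi, rfl⟩
    have hik : i ∈ U k := Set.mem_biUnion hj.1 hi
    by_cases him : i ∈ ⋃ m < k, U m
    · refine span_mono Set.subset_union_right ?_
      rw [← supported_eq_span_single, mem_supported]
      obtain ⟨m, hm, him⟩ := Set.mem_iUnion₂.mp him
      exact (hsupp him).trans (Set.subset_biUnion_of_mem (u := C) hm)
    · exact subset_span (Or.inl ⟨i, ⟨hik, him⟩, rfl⟩)
  choose ψ hψinj hψ using hblock
  have hrank (j : J) : ∃ k, j ∈ C k \ ⋃ m < k, C m := by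
    obtain ⟨k, hk, hmin⟩ := wellFounded_lt.has_min {k | j ∈ C k} ⟨j, Relation.ReflTransGen.refl⟩
    refine ⟨k, hk, fun h ↦ ?_⟩
    obtain ⟨m, hm, hjm⟩ := Set.mem_iUnion₂.mp h
    exact hmin m hjm hm
  choose ρ hρ using hrank
  refine ⟨fun j ↦ ψ (ρ j) ⟨j, hρ j⟩, fun j k hjk ↦ ?_, fun j ↦ (hψ (ρ j) ⟨j, hρ j⟩).2⟩
  have hle {j k : J} (hjk : ψ (ρ j) ⟨j, hρ j⟩ = ψ (ρ k) ⟨k, hρ k⟩) : ρ j ≤ ρ k := by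
    refine le_of_not_gt fun hlt ↦ (hψ (ρ j) ⟨j, hρ j⟩).1.2 ?_
    exact hjk ▸ Set.mem_biUnion (t := U) hlt (hψ (ρ k) ⟨k, hρ k⟩).1.1
  have heq : ρ j = ρ k := (hle hjk).antisymm (hle hjk.symm)
  have hcongr {m : J} (hm : ρ j = m) (hk : k ∈ C m \ ⋃ n < m, C n)
      (h : ψ (ρ j) ⟨j, hρ j⟩ = ψ m ⟨k, hk⟩) : j = k := by
    subst hm
    exact congrArg Subtype.val (hψinj _ h)
  exact hcongr heq (hρ k) hjk


/-- **Theorem (main).** If the homogeneous thin linear equation system `Ax = 0` given by a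
row-thin matrix `A : I × J → 𝔽` has only the trivial solution, then there is an injection
`φ : J → I` with `A (φ j) j ≠ 0` for every `j`. -/
theorem matching_variables_to_equations {I J F : Type*} [Field F] (A : I → J → F)
    (hrowthin : ∀ i : I, {j : J | A i j ≠ 0}.Finite)
    (htrivial : ∀ l : J → F, (∀ i : I, ∑ᶠ j : J, A i j * l j = 0) → l = 0) :
    ∃ φ : J → I, Function.Injective φ ∧ ∀ j : J, A (φ j) j ≠ 0 := by
  let v (i : I) : J →₀ F := Finsupp.ofSupportFinite (A i) (hrowthin i)
  refine exists_injective_apply_ne_zero_of_span_eq_top v (by_contra fun hv ↦ ?_)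
  obtain ⟨f, hf, hle⟩ := Submodule.exists_le_ker_of_lt_top _ (lt_top_iff_ne_top.mpr hv)
  refine hf (Finsupp.lhom_ext' fun j ↦ LinearMap.ext_ring ?_)
  refine congrFun (htrivial (fun j ↦ f (Finsupp.single j 1)) fun i ↦ ?_) j
  have hsub : (Function.support fun j ↦ A i j * f (Finsupp.single j 1)) ⊆ (v i).support :=
    fun j hj ↦ Finsupp.mem_support_iff.mpr (left_ne_zero_of_mul hj)
  rw [finsum_eq_sum_of_support_subset _ hsub]
  have hfv : f (v i) = 0 := hle (Submodule.subset_span ⟨i, rfl⟩)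
  rw [← Finsupp.sum_single (v i), Finsupp.sum, map_sum] at hfv
  rw [← hfv]
  refine Finset.sum_congr rfl fun j _ ↦ ?_
  rw [← mul_one (v i j), ← smul_eq_mul (v i j), ← Finsupp.smul_single, map_smul, smul_eq_mul]
  rfl
end

section
/- Let I and J be sets, let 𝔽 be a field, and let A : I × J → 𝔽 be a matrix such that the family of rows (j ↦ A(i,j) : i ∈ I), viewed as a family in 𝔽^J, and the family of columns (i ↦ A(i,j) : j ∈ J), viewed as a family in 𝔽^I, are both thinly independent. Then there is a bijection ψ : J → I such that A(ψ(j), j) ≠ 0 for every j ∈ J. -/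
/-- If the columns of a matrix are finitely supported and no nonzero combination of them vanishes,
then Hall's theorem provides an injective choice of a nonzero entry in every column. -/
theorem exists_injective_forall_ne_zero {I J F : Type*} [Field F] (A : I → J → F)
    (hfin : ∀ j : J, {i : I | A i j ≠ 0}.Finite)
    (hindep : ∀ l : J → F, (∀ i : I, ∑ᶠ j : J, l j * A i j = 0) → l = 0) :
    ∃ f : J → I, Function.Injective f ∧ ∀ j : J, A (f j) j ≠ 0 := by
  classical
  suffices h : ∀ s : Finset J, s.card ≤ (s.biUnion fun j => (hfin j).toFinset).card by
    obtain ⟨f, hf, hfA⟩ := (Finset.all_card_le_biUnion_card_iff_exists_injective _).1 h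
    exact ⟨f, hf, fun j => by simpa using hfA j⟩
  intro s
  set N := s.biUnion fun j => (hfin j).toFinset
  have hli : LinearIndependent F (fun (j : s) (i : N) => A i j) := by
    rw [Fintype.linearIndependent_iff]
    intro g hg
    let l : J → F := fun j => if h : j ∈ s then g ⟨j, h⟩ else 0
    have hl : l = 0 := by
      refine hindep l fun i => ?_
      by_cases hi : i ∈ N
      · rw [finsum_eq_sum_of_support_subset (s := s), ← Finset.sum_coe_sort]
        · simpa [l] using congrFun hg ⟨i, hi⟩
        · intro j hj
          by_contra hjs
          exact hj (by simp [l, show j ∉ s from hjs])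
      · refine finsum_eq_zero_of_forall_eq_zero fun j => ?_
        by_cases hj : j ∈ s
        · have hij : A i j = 0 := by
            by_contra hij
            exact hi (Finset.mem_biUnion.2 ⟨j, hj, by simpa using hij⟩)
          simp [hij]
        · simp [l, hj]
    intro j
    simpa [l] using congrFun hl j
  simpa using hli.fintype_card_le_finrank

/-- **Corollary.** If both the family of rows and the family of columns of a matrix
`A : I × J → 𝔽` are thinly independent, then there is a bijection `ψ : J → I` with
`A (ψ j) j ≠ 0` for every `j`.  (A family being thin is part of the data; thin independence
says that the only thin linear combination producing the zero function is the trivial one.) -/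
theorem bijection_variables_to_equations {I J F : Type*} [Field F] (A : I → J → F)
    (hrowthin : ∀ j : J, {i : I | A i j ≠ 0}.Finite)
    (hcolthin : ∀ i : I, {j : J | A i j ≠ 0}.Finite)
    (hrowindep : ∀ l : I → F, (∀ j : J, ∑ᶠ i : I, l i * A i j = 0) → l = 0)
    (hcolindep : ∀ l : J → F, (∀ i : I, ∑ᶠ j : J, l j * A i j = 0) → l = 0) :
    ∃ ψ : J → I, Function.Bijective ψ ∧ ∀ j : J, A (ψ j) j ≠ 0 := by
  obtain ⟨f, hf, hfA⟩ := exists_injective_forall_ne_zero A hrowthin hcolindep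
  obtain ⟨g, hg, hgA⟩ := exists_injective_forall_ne_zero (fun j i => A i j) hcolthin hrowindep
  exact Function.Embedding.schroeder_bernstein_of_rel hf hg (fun j i => A i j ≠ 0) hfA hgA
end

section
/- Let G = (S, T, E) be a bipartite graph. If G admits a matching that covers S, then μ_G(f) ≥ 0 for every saturated string f corresponding to G. -/
open Classical in
/-- The quantity `μ_G(f)` of Wojciechowski, defined by transfinite recursion on the domain
of the string `f`.  Here `S` is the first vertex class of the bipartite graph: at a
successor step we subtract `1` if the last vertex lies in `S` and add `1` otherwise
(i.e. when it lies in `T`), and at a limit ordinal we take the `liminf` of the previous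
values.  Values lie in `ℤ ∪ {−∞, +∞}`, embedded in `EReal`. -/
noncomputable def mu {V : Type*} (S : Set V) (f : Ordinal → V) : Ordinal → EReal :=
  fun α => Ordinal.limitRecOn α (0 : EReal)
    (fun β ih => if f β ∈ S then ih - 1 else ih + 1)
    (fun α _ ih => ⨆ γ : Set.Iio α, ⨅ β : Set.Iio α,
      if (γ : Ordinal) ≤ (β : Ordinal) then ih β.1 β.2 else ⊤)

theorem mu_zero {V : Type*} (S : Set V) (f : Ordinal → V) : mu S f 0 = 0 :=
  Ordinal.limitRecOn_zero ..

open Classical in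
theorem mu_add_one {V : Type*} (S : Set V) (f : Ordinal → V) (β : Ordinal) :
    mu S f (β + 1) = if f β ∈ S then mu S f β - 1 else mu S f β + 1 :=
  Ordinal.limitRecOn_add_one ..

theorem mu_limit {V : Type*} (S : Set V) (f : Ordinal → V) {α : Ordinal}
    (hα : Order.IsSuccLimit α) :
    mu S f α = ⨆ γ : Set.Iio α, ⨅ β : Set.Iio α,
      if (γ : Ordinal) ≤ (β : Ordinal) then mu S f β else ⊤ :=
  Ordinal.limitRecOn_limit _ _ _ _ hα

/-- A lower bound for `mu` at a limit stage follows from a lower bound at all stages from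
some point on. -/
theorem le_mu_limit {V : Type*} {S : Set V} {f : Ordinal → V} {α : Ordinal}
    (hα : Order.IsSuccLimit α) {c : EReal} {γ : Ordinal} (hγ : γ < α)
    (h : ∀ β < α, γ ≤ β → c ≤ mu S f β) : c ≤ mu S f α := by
  rw [mu_limit S f hα]
  refine le_iSup_of_le ⟨γ, hγ⟩ (le_iInf fun β => ?_)
  split_ifs with hβ
  · exact h β.1 β.2 hβ
  · exact le_top

/-- The vertices outside `S` that occur in the string `f` before stage `β`, but are not matched
by `M` to a vertex of `S` occurring before stage `β`. -/
def unmatchedBefore {V : Type*} (S : Set V) (M : Set (Sym2 V)) (f : Ordinal → V)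
    (β : Ordinal) : Set V :=
  {t | t ∉ S ∧ (∃ γ < β, f γ = t) ∧ ∀ δ < β, f δ ∈ S → s(f δ, t) ∉ M}

theorem unmatchedBefore_add_one_subset {V : Type*} (S : Set V) (M : Set (Sym2 V))
    (f : Ordinal → V) (β : Ordinal) {t : V} (ht : t ∈ unmatchedBefore S M f (β + 1))
    (hne : t ≠ f β) : t ∈ unmatchedBefore S M f β := by
  obtain ⟨htS, ⟨γ, hγ, rfl⟩, hM⟩ := ht
  refine ⟨htS, ⟨γ, ?_, rfl⟩, fun δ hδ => hM δ (hδ.trans (Order.lt_add_one_iff.2 le_rfl))⟩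
  exact (Order.lt_add_one_iff.1 hγ).lt_of_ne fun h => hne (h ▸ rfl)

/-- Finitely many vertices that are unmatched before a limit stage are all unmatched before every
sufficiently late earlier stage. -/
theorem exists_subset_unmatchedBefore {V : Type*} {S : Set V} {M : Set (Sym2 V)}
    {f : Ordinal → V} {α : Ordinal} (hα : Order.IsSuccLimit α) (F : Finset V)
    (hF : ∀ t ∈ F, t ∈ unmatchedBefore S M f α) :
    ∃ γ < α, ∀ β < α, γ ≤ β → ∀ t ∈ F, t ∈ unmatchedBefore S M f β := by
  classical
  induction F using Finset.induction_on with
  | empty => exact ⟨0, hα.bot_lt, by simp⟩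
  | insert t F _ ih =>
    obtain ⟨γ, hγ, h⟩ := ih fun u hu => hF u (Finset.mem_insert_of_mem hu)
    obtain ⟨htS, ⟨ε, hε, hεt⟩, hM⟩ := hF t (Finset.mem_insert_self t F)
    refine ⟨max γ (ε + 1), max_lt hγ (hα.add_one_lt hε), fun β hβ hle u hu => ?_⟩
    rcases Finset.mem_insert.1 hu with rfl | hu
    · exact ⟨htS, ⟨ε, Order.add_one_le_iff.1 ((le_max_right _ _).trans hle), hεt⟩,
        fun δ hδ => hM δ (hδ.trans hβ)⟩
    · exact h β hβ ((le_max_left _ _).trans hle) u hu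

/-- If every vertex of `S` in the string has a partner under `M` that occurs earlier, then `mu`
is at least the number of unmatched vertices. -/
theorem card_le_mu {V : Type*} {S : Set V} {M : Set (Sym2 V)} {f : Ordinal → V} {α : Ordinal}
    (hpartner : ∀ β < α, f β ∈ S → ∃ t ∈ unmatchedBefore S M f β, s(f β, t) ∈ M)
    (F : Finset V) (hF : ∀ t ∈ F, t ∈ unmatchedBefore S M f α) :
    ((F.card : ℝ) : EReal) ≤ mu S f α := by
  classical
  induction α using Ordinal.limitRecOn generalizing F with
  | zero =>
    have : F = ∅ := Finset.eq_empty_of_forall_notMem fun t ht => by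
      obtain ⟨_, ⟨γ, hγ, _⟩, _⟩ := hF t ht
      exact not_lt_bot hγ
    simp [this, mu_zero]
  | add_one β ih =>
    have hβ : β < β + 1 := Order.lt_add_one_iff.2 le_rfl
    replace ih := ih fun γ hγ => hpartner γ (hγ.trans hβ)
    rw [mu_add_one]
    split_ifs with hS
    · obtain ⟨t, ht, htM⟩ := hpartner β hβ hS
      have htF : t ∉ F := fun h => (hF t h).2.2 β hβ hS htM
      have key := ih (insert t F) fun u hu => by
        rcases Finset.mem_insert.1 hu with rfl | hu
        · exact ht
        · exact unmatchedBefore_add_one_subset S M f β (hF u hu)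
            fun h => (hF u hu).1 (h ▸ hS)
      rw [Finset.card_insert_of_notMem htF] at key
      push_cast at key
      exact (EReal.le_sub_iff_add_le (.inl (EReal.coe_ne_bot 1)) (.inl (EReal.coe_ne_top 1))).2 key
    · have key := ih (F.erase (f β)) fun u hu =>
        unmatchedBefore_add_one_subset S M f β (hF u (Finset.mem_of_mem_erase hu))
          (Finset.ne_of_mem_erase hu)
      have hcard : (F.card : ℝ) ≤ (F.erase (f β)).card + 1 := by
        have := F.pred_card_le_card_erase (a := f β)
        exact_mod_cast Nat.sub_le_iff_le_add.1 this
      calc ((F.card : ℝ) : EReal) ≤ (((F.erase (f β)).card + 1 : ℝ) : EReal) :=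
            EReal.coe_le_coe_iff.2 hcard
        _ = (((F.erase (f β)).card : ℝ) : EReal) + 1 := by push_cast; rfl
        _ ≤ mu S f β + 1 := by gcongr
  | limit α hα ih =>
    obtain ⟨γ, hγ, h⟩ := exists_subset_unmatchedBefore hα F hF
    exact le_mu_limit hα hγ fun β hβ hle =>
      ih β hβ (fun δ hδ => hpartner δ (hδ.trans hβ)) F (h β hβ hle)

/-- If a bipartite graph `G = (S, T, E)` admits a matching covering `S`, then
`μ_G(f) ≥ 0` for every saturated string `f` (an injective ordinal-indexed sequence of
vertices, with domain `α`, in which every vertex of `S` appears only after all of its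
neighbours). -/
theorem mu_nonneg_of_matching {V : Type*} (S T : Set V) (E : Set (Sym2 V))
    (hST : Disjoint S T)
    (hE : ∀ e ∈ E, ∃ a ∈ S, ∃ b ∈ T, e = s(a, b))
    (M : Set (Sym2 V)) (hME : M ⊆ E)
    (hmatch : ∀ e₁ ∈ M, ∀ e₂ ∈ M, e₁ ≠ e₂ → ∀ v : V, v ∈ e₁ → v ∉ e₂)
    (hcover : ∀ v ∈ S, ∃ e ∈ M, v ∈ e)
    (f : Ordinal → V) (α : Ordinal)
    (hinj : ∀ β < α, ∀ γ < α, f β = f γ → β = γ)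
    (hran : ∀ β < α, f β ∈ S ∪ T)
    (hsat : ∀ β < α, f β ∈ S → ∀ w : V, s(f β, w) ∈ E → ∃ γ < β, f γ = w) :
    0 ≤ mu S f α := by
  have hpartner : ∀ β < α, f β ∈ S → ∃ t ∈ unmatchedBefore S M f β, s(f β, t) ∈ M := by
    intro β hβ hS
    obtain ⟨e, heM, hve⟩ := hcover _ hS
    obtain ⟨a, ha, b, hb, rfl⟩ := hE e (hME heM)
    have hbS : b ∉ S := fun h => hST.notMem_of_mem_left h hb
    obtain rfl : f β = a := (Sym2.mem_iff.1 hve).resolve_right fun h => hbS (h ▸ hS)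
    refine ⟨b, ⟨hbS, hsat β hβ hS b (hME heM), fun δ hδ _ hδM => ?_⟩, heM⟩
    have heq : s(f δ, b) = s(f β, b) := by
      by_contra hne
      exact hmatch _ hδM _ heM hne b (Sym2.mem_mk_right _ _) (Sym2.mem_mk_right _ _)
    exact hδ.ne (hinj δ (hδ.trans hβ) β hβ (Sym2.congr_left.1 heq))
  simpa using card_le_mu hpartner ∅ (by simp)
end

section
/- Let I and J be sets, let 𝔽 be a field, let A : I × J → 𝔽 be a row-thin matrix, and let b ∈ 𝔽^I. If for every finite subset I₀ ⊆ I the finite subsystem ∑_{j ∈ J} A(i,j)·x_j = b_i (i ∈ I₀) is solvable, then the whole thin linear equation system Ax = b is solvable. -/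
/-- **Compactness of thin linear equation systems (Cowen–Emerson).** If every finite
subsystem of a thin linear equation system `Ax = b` is solvable, then the whole system
is solvable. -/
theorem thin_linear_system_compactness {I J F : Type*} [Field F] (A : I → J → F) (b : I → F)
    (hrowthin : ∀ i : I, {j : J | A i j ≠ 0}.Finite)
    (hfin : ∀ I₀ : Finset I, ∃ l : J → F, ∀ i ∈ I₀, ∑ᶠ j : J, A i j * l j = b i) :
    ∃ l : J → F, ∀ i : I, ∑ᶠ j : J, A i j * l j = b i := by
  let a (i : I) : J →₀ F := Finsupp.ofSupportFinite (A i) (hrowthin i)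
  have eval_row (l : J → F) (i : I) :
      ∑ᶠ j : J, A i j * l j = Finsupp.linearCombination F l (a i) := by
    rw [Finsupp.linearCombination_apply, Finsupp.sum]
    refine finsum_eq_sum_of_support_subset _ fun j hj => ?_
    exact Finsupp.mem_support_iff.2 (left_ne_zero_of_mul hj)
  simp only [eval_row] at hfin ⊢
  have hker : Finsupp.linearCombination F b ∈
      (Finsupp.linearCombination F a).ker.dualAnnihilator := by
    refine (Submodule.mem_dualAnnihilator _).2 fun c hc => ?_
    obtain ⟨l, hl⟩ := hfin c.support
    have h := congrArg (Finsupp.linearCombination F l) (LinearMap.mem_ker.1 hc)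
    rw [Finsupp.linearCombination_apply F (v := a), map_finsuppSum, map_zero] at h
    rw [Finsupp.linearCombination_apply, ← h]
    refine Finset.sum_congr rfl fun i hi => ?_
    simp only [map_smul, hl i hi]
  rw [← LinearMap.range_dualMap_eq_dualAnnihilator_ker] at hker
  obtain ⟨g, hg⟩ := hker
  refine ⟨fun j => g (Finsupp.single j 1), fun i => ?_⟩
  have hcomb : Finsupp.linearCombination F (fun j => g (Finsupp.single j 1)) = g := by
    ext j
    simp
  rw [hcomb]
  simpa using LinearMap.congr_fun hg (Finsupp.single i 1)
end

section
/- Let G = (S, T, E) be a bipartite graph. If there exist a matching M_S in G that covers S and a matching M_T in G that covers T, then G admits a perfect matching, i.e. a matching covering S ∪ T. -/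
/-- A matching between disjoint sets `A` and `B` that covers `A` induces an injection `A → B`
along its edges. -/
theorem exists_injective_of_matching_covers {V : Type*} {A B : Set V} {M : Set (Sym2 V)}
    (hAB : Disjoint A B) (hM : ∀ e ∈ M, ∃ a ∈ A, ∃ b ∈ B, e = s(a, b))
    (hmatch : ∀ e₁ ∈ M, ∀ e₂ ∈ M, e₁ ≠ e₂ → ∀ v : V, v ∈ e₁ → v ∉ e₂)
    (hcover : ∀ v ∈ A, ∃ e ∈ M, v ∈ e) :
    ∃ f : A → B, Function.Injective f ∧ ∀ a : A, s((a : V), (f a : V)) ∈ M := by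
  have key : ∀ a : A, ∃ b : B, s((a : V), (b : V)) ∈ M := by
    rintro ⟨a, ha⟩
    obtain ⟨e, he, hae⟩ := hcover a ha
    obtain ⟨x, hx, y, hy, rfl⟩ := hM e he
    rcases Sym2.mem_iff.1 hae with rfl | rfl
    · exact ⟨⟨y, hy⟩, he⟩
    · exact (Set.disjoint_left.1 hAB ha hy).elim
  choose f hf using key
  refine ⟨f, fun a a' h => ?_, hf⟩
  by_contra hne
  refine hmatch _ (hf a) _ (hf a') (fun heq => hne ?_) (f a)
    (Sym2.mem_mk_right _ _) (h ▸ Sym2.mem_mk_right _ _)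
  rw [h] at heq
  exact Subtype.ext (Sym2.congr_left.1 heq)

/-- **Cantor–Bernstein, graph-theoretic form.** If a bipartite graph `G = (S, T, E)` has a
matching `M_S` covering `S` and a matching `M_T` covering `T`, then `G` admits a perfect
matching, i.e. a matching covering `S ∪ T`. -/
theorem perfect_matching_of_two_matchings {V : Type*} (S T : Set V) (E : Set (Sym2 V))
    (hST : Disjoint S T)
    (hE : ∀ e ∈ E, ∃ a ∈ S, ∃ b ∈ T, e = s(a, b))
    (MS MT : Set (Sym2 V)) (hMSE : MS ⊆ E) (hMTE : MT ⊆ E)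
    (hMSmatch : ∀ e₁ ∈ MS, ∀ e₂ ∈ MS, e₁ ≠ e₂ → ∀ v : V, v ∈ e₁ → v ∉ e₂)
    (hMTmatch : ∀ e₁ ∈ MT, ∀ e₂ ∈ MT, e₁ ≠ e₂ → ∀ v : V, v ∈ e₁ → v ∉ e₂)
    (hMScover : ∀ v ∈ S, ∃ e ∈ MS, v ∈ e)
    (hMTcover : ∀ v ∈ T, ∃ e ∈ MT, v ∈ e) :
    ∃ M ⊆ E, (∀ e₁ ∈ M, ∀ e₂ ∈ M, e₁ ≠ e₂ → ∀ v : V, v ∈ e₁ → v ∉ e₂) ∧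
      ∀ v ∈ S ∪ T, ∃ e ∈ M, v ∈ e := by
  obtain ⟨f, hf, hfM⟩ := exists_injective_of_matching_covers hST
    (fun e he => hE e (hMSE he)) hMSmatch hMScover
  obtain ⟨g, hg, hgM⟩ := exists_injective_of_matching_covers hST.symm
    (fun e he => by
      obtain ⟨a, ha, b, hb, rfl⟩ := hE e (hMTE he)
      exact ⟨b, hb, a, ha, Sym2.eq_swap⟩) hMTmatch hMTcover
  obtain ⟨h, ⟨hinj, hsurj⟩, hadj⟩ := Function.Embedding.schroeder_bernstein_of_rel hf hg
    (fun a b => s((a : V), (b : V)) ∈ E) (fun a => hMSE (hfM a))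
    (fun b => by rw [Sym2.eq_swap]; exact hMTE (hgM b))
  refine ⟨Set.range fun a : S => s((a : V), (h a : V)), ?_, ?_, ?_⟩
  · rintro _ ⟨a, rfl⟩
    exact hadj a
  · rintro _ ⟨a, rfl⟩ _ ⟨a', rfl⟩ hne v hv hv'
    have hab : a ≠ a' := fun H => hne (by rw [H])
    rcases Sym2.mem_iff.1 hv with rfl | rfl <;> rcases Sym2.mem_iff.1 hv' with H | H
    · exact hab (Subtype.ext H)
    · exact Set.disjoint_left.1 hST a.2 (H ▸ (h a').2)
    · exact Set.disjoint_left.1 hST a'.2 (H ▸ (h a).2)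
    · exact hab (hinj (Subtype.ext H))
  · rintro v (hv | hv)
    · exact ⟨_, ⟨⟨v, hv⟩, rfl⟩, Sym2.mem_mk_left _ _⟩
    · obtain ⟨a, ha⟩ := hsurj ⟨v, hv⟩
      exact ⟨_, ⟨a, rfl⟩, by simp [ha]⟩
end

section
/- Let I and J be finite sets, let 𝔽 be a field, and let A : I × J → 𝔽 be a matrix. If the finite homogeneous linear equation system ∑_{j ∈ J} A(i,j)·x_j = 0 (i ∈ I) has only the trivial solution λ = 0 in 𝔽^J, then there exists an injection φ : J → I such that A(φ(j), j) ≠ 0 for every j ∈ J. -/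
/-- **Finite case.** If a finite homogeneous linear equation system `Ax = 0` has only the
trivial solution, then there is an injection `φ : J → I` with `A (φ j) j ≠ 0` for all `j`. -/
theorem matching_variables_to_equations_finite {I J F : Type*} [Fintype I] [Fintype J]
    [Field F] (A : I → J → F)
    (htrivial : ∀ l : J → F, (∀ i : I, ∑ j : J, A i j * l j = 0) → l = 0) :
    ∃ φ : J → I, Function.Injective φ ∧ ∀ j : J, A (φ j) j ≠ 0 := by
  classical
  let t : J → Finset I := fun j ↦ {i | A i j ≠ 0}
  suffices hall : ∀ S : Finset J, S.card ≤ (S.biUnion t).card by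
    obtain ⟨φ, hφ, h⟩ := (Finset.all_card_le_biUnion_card_iff_exists_injective t).1 hall
    exact ⟨φ, hφ, fun j ↦ by simpa [t] using h j⟩
  intro S
  let B : Matrix (S.biUnion t) S F := Matrix.of fun i j ↦ A i j
  suffices hB : Function.Injective B.mulVecLin by
    simpa only [Module.finrank_fintype_fun_eq_card, Fintype.card_coe] using
      LinearMap.finrank_le_finrank_of_injective hB
  rw [injective_iff_map_eq_zero]
  intro l hl
  let l' : J → F := fun j ↦ if h : j ∈ S then l ⟨j, h⟩ else 0
  have hsum (i : I) : ∑ j, A i j * l' j = ∑ j : S, A i j * l j := by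
    rw [← Finset.sum_subset (Finset.subset_univ S) fun j _ hj ↦ by simp [l', hj],
      ← Finset.sum_coe_sort S]
    simp [l']
  have hl' : l' = 0 := htrivial l' fun i ↦ by
    rw [hsum]
    by_cases hi : i ∈ S.biUnion t
    · exact congrFun hl ⟨i, hi⟩
    · refine Finset.sum_eq_zero fun j _ ↦ ?_
      have hij : A i j = 0 := by
        by_contra h
        exact hi (Finset.mem_biUnion.2 ⟨j, j.2, by simpa [t] using h⟩)
      rw [hij, zero_mul]
  ext j
  simpa [l'] using congrFun hl' j
end

section
/- In GF(2)^ℕ, consider the family consisting of all unit vectors e_n (n ∈ ℕ), where e_n(m) = 1 if m = n and 0 otherwise, together with the constant-1 vector 𝟙. This family is linearly independent (in the usual sense of finite linear combinations) and thin, yet there is no injection from the index set of the family to ℕ mapping each member of the family to an element of its support, where the support of f ∈ GF(2)^ℕ is the set of n ∈ ℕ with f(n) ≠ 0. -/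
/-- **Example.** In `GF(2)^ℕ`, the family consisting of all unit vectors `e_n` (`n ∈ ℕ`)
together with the constant-`1` vector (indexed by `Option ℕ`, where `some n` indexes `e_n`
and `none` indexes `𝟙`) is linearly independent and thin, yet there is no injection from
the index set to `ℕ` mapping each member of the family to an element of its support. -/
theorem unit_vectors_with_ones_counterexample (f : Option ℕ → ℕ → ZMod 2)
    (hsome : ∀ m n : ℕ, f (some m) n = if n = m then 1 else 0)
    (hnone : ∀ n : ℕ, f none n = 1) :
    LinearIndependent (ZMod 2) f ∧
      (∀ n : ℕ, {k : Option ℕ | f k n ≠ 0}.Finite) ∧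
      ¬ ∃ φ : Option ℕ → ℕ, Function.Injective φ ∧ ∀ k : Option ℕ, f k (φ k) ≠ 0 := by
  refine ⟨?_, fun n => ?_, ?_⟩
  · rw [linearIndependent_iff]
    intro l hl
    have hcoord (n : ℕ) : l none + l (some n) = 0 := by
      have h := congrFun hl n
      rw [Finsupp.linearCombination_apply, Finsupp.sum_option_index_smul] at h
      by_cases h0 : l (some n) = 0 <;>
        simpa [Finsupp.sum, Finset.sum_apply, hsome, hnone, h0] using h
    obtain ⟨n, hn⟩ := Infinite.exists_notMem_finset l.some.support
    have hn' : l (some n) = 0 := by simpa using hn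
    have h0 : l none = 0 := by simpa [hn'] using hcoord n
    ext (_ | m)
    · exact h0
    · simpa [h0] using hcoord m
  · refine (Set.toFinite {none, some n}).subset ?_
    rintro (_ | m) hk
    · simp
    · have hnm : n = m := by simpa [hsome] using hk
      simp [hnm]
  · rintro ⟨φ, hinj, hφ⟩
    have hfix (m : ℕ) : φ (some m) = m := by simpa [hsome] using hφ (some m)
    exact Option.some_ne_none _ (hinj (hfix (φ none)))
end
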